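/- arXiv:2602.18427 — 2 statements merged into one kernel-verified Lean document; each statement's English description precedes it below -/
import Mathlib

section
/- Let n ≥ 1 be odd and set k = ⌊n/2⌋. The convex hull in ℝ^{n×k} of the set { (x_{i,j})_{i∈{1,…,n}, j∈{1,…,k}} : X is an n×n VSASM } (the left n×k blocks of VSASMs) equals the set of Y ∈ ℝ^{n×k} satisfying: (i) 0 ≤ ∑_{j'=1}^{j} y_{i,j'} ≤ 1 for all i ∈ {1,…,n} and j ∈ {1,…,k−1}; (ii) 0 ≤ ∑_{i'=1}^{i} y_{i',j} ≤ 1 for all i ∈ {1,…,n−1} and j ∈ {1,…,k}; (iii) ∑_{j=1}^{k} y_{i,j} = 1 if i is even and = 0 if i is odd, for all i ∈ {1,…,n}; and (iv) ∑_{i=1}^{n} y_{i,j} = 1 for all j ∈ {1,…,k}. -/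
/-- An `n × n` alternating sign matrix: entries in `{-1, 0, 1}`, all row- and
column-prefix sums lie in `{0, 1}`, and all full row and column sums equal `1`. -/
def IsASM (n : ℕ) (X : Fin n → Fin n → ℝ) : Prop :=
  (∀ i j, X i j = -1 ∨ X i j = 0 ∨ X i j = 1) ∧
  (∀ i j, (∑ j' ∈ Finset.Iic j, X i j') = 0 ∨ (∑ j' ∈ Finset.Iic j, X i j') = 1) ∧
  (∀ i j, (∑ i' ∈ Finset.Iic i, X i' j) = 0 ∨ (∑ i' ∈ Finset.Iic i, X i' j) = 1) ∧
  (∀ i, (∑ j, X i j) = 1) ∧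
  (∀ j, (∑ i, X i j) = 1)

open MeasureTheory

theorem Fin.sum_Iic_eq_sum_range {n : ℕ} (f : ℕ → ℝ) (j : Fin n) :
    ∑ j' ∈ Finset.Iic j, f j' = ∑ m ∈ Finset.range (j + 1), f m := by
  rw [Nat.range_succ_eq_Iic, ← Fin.map_valEmbedding_Iic, Finset.sum_map]
  rfl

theorem exists_nat_extension {m n : ℕ} (Y : Fin m → Fin n → ℝ) :
    ∃ y : ℕ → ℕ → ℝ, Y = fun (i : Fin m) (j : Fin n) => y i j := by
  refine ⟨fun i j => if h : i < m ∧ j < n then Y ⟨i, h.1⟩ ⟨j, h.2⟩ else 0, ?_⟩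
  ext i j
  simp

theorem Finset.sum_range_of_symm (k : ℕ) (F : ℕ → ℝ) (hF : ∀ m < k, F (2 * k - m) = F m) :
    ∑ m ∈ Finset.range (2 * k + 1), F m = 2 * ∑ m ∈ Finset.range k, F m + F k := by
  have h : ∑ m ∈ Finset.range k, F (k + 1 + m) = ∑ m ∈ Finset.range k, F m := by
    rw [← Finset.sum_range_reflect]
    refine Finset.sum_congr rfl fun m hm => ?_
    have hm := Finset.mem_range.1 hm
    rw [← hF m hm]
    congr 1
    omega
  rw [show 2 * k + 1 = (k + 1) + k by ring, Finset.sum_range_add, Finset.sum_range_succ, h]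
  ring

/-- A matrix is the mixed difference of its corner sums; integer corner sums with increments in
`{0, 1}` and the right boundary values come from an alternating sign matrix. -/
theorem isASM_of_cornerSum (n : ℕ) (G : ℕ → ℕ → ℤ) (htop : ∀ b ≤ n, G 0 b = 0)
    (hleft : ∀ a ≤ n, G a 0 = 0) (hright : ∀ a ≤ n, G a n = a) (hbot : ∀ b ≤ n, G n b = b)
    (hrow : ∀ i < n, ∀ b ≤ n, G (i + 1) b - G i b = 0 ∨ G (i + 1) b - G i b = 1)
    (hcol : ∀ a ≤ n, ∀ j < n, G a (j + 1) - G a j = 0 ∨ G a (j + 1) - G a j = 1) :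
    IsASM n fun i j => ((G (i + 1) (j + 1) - G i (j + 1) - (G (i + 1) j - G i j) : ℤ) : ℝ) := by
  have row : ∀ i b : ℕ, ∑ j ∈ Finset.range b,
      ((G (i + 1) (j + 1) - G i (j + 1) - (G (i + 1) j - G i j) : ℤ) : ℝ) =
        ((G (i + 1) b - G i b - (G (i + 1) 0 - G i 0) : ℤ) : ℝ) := by
    intro i b
    rw [← Finset.sum_range_sub (fun j => G (i + 1) j - G i j)]
    push_cast
    rfl
  have col : ∀ a j : ℕ, ∑ i ∈ Finset.range a,
      ((G (i + 1) (j + 1) - G i (j + 1) - (G (i + 1) j - G i j) : ℤ) : ℝ) =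
        ((G a (j + 1) - G a j - (G 0 (j + 1) - G 0 j) : ℤ) : ℝ) := by
    intro a j
    rw [← Finset.sum_range_sub (fun i => G i (j + 1) - G i j)]
    push_cast
    refine Finset.sum_congr rfl fun i _ => ?_
    ring
  refine ⟨fun i j => ?_, fun i j => ?_, fun i j => ?_, fun i => ?_, fun j => ?_⟩
  · have h1 := hrow i i.2 (j + 1) j.2
    have h2 := hrow i i.2 j j.2.le
    have : G (i + 1) (j + 1) - G i (j + 1) - (G (i + 1) j - G i j) = -1 ∨
      G (i + 1) (j + 1) - G i (j + 1) - (G (i + 1) j - G i j) = 0 ∨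
      G (i + 1) (j + 1) - G i (j + 1) - (G (i + 1) j - G i j) = 1 := by omega
    rcases this with h | h | h <;> simp only [h] <;> simp
  · rw [Fin.sum_Iic_eq_sum_range (fun m =>
      ((G (i + 1) (m + 1) - G i (m + 1) - (G (i + 1) m - G i m) : ℤ) : ℝ)), row,
      hleft _ i.2, hleft _ i.2.le]
    simpa only [sub_zero, Int.cast_eq_zero, Int.cast_eq_one] using hrow i i.2 (j + 1) j.2
  · rw [Fin.sum_Iic_eq_sum_range (fun m =>
      ((G (m + 1) (j + 1) - G m (j + 1) - (G (m + 1) j - G m j) : ℤ) : ℝ)), col,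
      htop _ j.2, htop _ j.2.le]
    simpa only [sub_zero, Int.cast_eq_zero, Int.cast_eq_one] using hcol (i + 1) i.2 j j.2
  · rw [Fin.sum_univ_eq_sum_range (fun m =>
      ((G (i + 1) (m + 1) - G i (m + 1) - (G (i + 1) m - G i m) : ℤ) : ℝ)), row,
      hleft _ i.2, hleft _ i.2.le, hright _ i.2, hright _ i.2.le]
    simp
  · rw [Fin.sum_univ_eq_sum_range (fun m =>
      ((G (m + 1) (j + 1) - G m (j + 1) - (G (m + 1) j - G m j) : ℤ) : ℝ)), col,
      htop _ j.2, htop _ j.2.le, hbot _ j.2, hbot _ j.2.le]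
    simp

/-- Reflecting the left half of a corner-sum array yields a vertically symmetric ASM. -/
theorem exists_vsasm_of_cornerSum (k : ℕ) (hk : k ≤ 2 * k + 1) (G : ℕ → ℕ → ℤ)
    (htop : ∀ b ≤ k, G 0 b = 0) (hleft : ∀ a ≤ 2 * k + 1, G a 0 = 0)
    (hmid : ∀ a ≤ 2 * k + 1, G a k = (a / 2 : ℕ)) (hbot : ∀ b ≤ k, G (2 * k + 1) b = b)
    (hrow : ∀ i < 2 * k + 1, ∀ b ≤ k, G (i + 1) b - G i b = 0 ∨ G (i + 1) b - G i b = 1)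
    (hcol : ∀ a ≤ 2 * k + 1, ∀ j < k, G a (j + 1) - G a j = 0 ∨ G a (j + 1) - G a j = 1) :
    ∃ X : Fin (2 * k + 1) → Fin (2 * k + 1) → ℝ, (IsASM (2 * k + 1) X ∧ ∀ i j, X i j = X i j.rev) ∧
      ∀ i (j : Fin k), X i (Fin.castLE hk j) =
        ((G (i + 1) (j + 1) - G i (j + 1) - (G (i + 1) j - G i j) : ℤ) : ℝ) := by
  set K : ℕ → ℕ → ℤ := fun a b => if b ≤ k then G a b else a - G a (2 * k + 1 - b) with hK
  have hKl : ∀ a b, b ≤ k → K a b = G a b := fun a b hb => by simp [hK, hb]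
  have hKr : ∀ a b, k < b → K a b = a - G a (2 * k + 1 - b) := fun a b hb => by
    simp [hK, hb.not_ge]
  have hsymm : ∀ a b, b ≤ 2 * k + 1 → K a (2 * k + 1 - b) = a - K a b := by
    intro a b hb
    rcases le_or_gt b k with h | h
    · rw [hKl a b h, hKr a _ (by omega), show 2 * k + 1 - (2 * k + 1 - b) = b by omega]
    · rw [hKr a b h, hKl a _ (by omega)]
      ring
  refine ⟨_, ⟨isASM_of_cornerSum (2 * k + 1) K ?_ ?_ ?_ ?_ ?_ ?_, ?_⟩, ?_⟩
  · intro b hb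
    rcases le_or_gt b k with h | h
    · rw [hKl _ b h, htop b h]
    · rw [hKr _ b h, htop _ (by omega)]
      simp
  · intro a ha
    rw [hKl _ _ (by omega), hleft a ha]
  · intro a ha
    rw [hKr _ _ (by omega), Nat.sub_self, hleft a ha, sub_zero]
  · intro b hb
    rcases le_or_gt b k with h | h
    · rw [hKl _ b h, hbot b h]
    · rw [hKr _ b h, hbot _ (by omega)]
      omega
  · intro i hi b hb
    rcases le_or_gt b k with h | h
    · rw [hKl _ b h, hKl _ b h]
      exact hrow i hi b h
    · rw [hKr _ b h, hKr _ b h]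
      have := hrow i hi (2 * k + 1 - b) (by omega)
      omega
  · intro a ha j hj
    rcases lt_trichotomy j k with h | h | h
    · rw [hKl _ _ (by omega), hKl _ _ h.le]
      exact hcol a ha j h
    · subst h
      rw [hKr _ _ (by omega), hKl _ _ le_rfl, show 2 * j + 1 - (j + 1) = j by omega, hmid a ha]
      omega
    · rw [hKr _ _ (by omega), hKr _ _ h]
      have := hcol a ha (2 * k + 1 - (j + 1)) (by omega)
      rw [show 2 * k + 1 - (j + 1) + 1 = 2 * k + 1 - j by omega] at this
      omega
  · intro i j
    have hj := j.2
    simp only [Fin.val_rev]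
    rw [show 2 * k + 1 - (j + 1) + 1 = 2 * k + 1 - j by omega]
    simp only [hsymm _ _ hj, hsymm _ _ hj.le]
    push_cast
    ring
  · intro i j
    have hj := j.2
    simp only [Fin.val_castLE]
    simp only [hKl _ _ hj.le, hKl _ _ (show (j : ℕ) + 1 ≤ k from hj)]

theorem intervalIntegrable_floor_const_add (a : ℝ) :
    IntervalIntegrable (fun t : ℝ => (⌊a + t⌋ : ℝ)) volume 0 1 :=
  Monotone.intervalIntegrable fun s t h => by
    simpa using Int.floor_mono (by linarith : a + s ≤ a + t)

theorem integral_floor_const_add (a : ℝ) : ∫ t in (0 : ℝ)..1, (⌊a + t⌋ : ℝ) = a := by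
  have hfr : ∫ t in (0 : ℝ)..1, Int.fract (a + t) = 1 / 2 := by
    rw [intervalIntegral.integral_comp_add_left (fun t => Int.fract t) a]
    have h := (Int.fract_periodic ℝ).intervalIntegral_add_eq a 0
    rw [zero_add] at h
    rw [add_zero, h]
    have : ∫ t in (0 : ℝ)..1, Int.fract t = ∫ t in (0 : ℝ)..1, t := by
      refine intervalIntegral.integral_congr_ae ?_
      have : ∀ᵐ t : ℝ, t ≠ 1 := by simp [ae_iff]
      filter_upwards [this] with t ht ht'
      rw [Set.uIoc_of_le zero_le_one] at ht'
      exact Int.fract_eq_self.2 ⟨ht'.1.le, lt_of_le_of_ne ht'.2 ht⟩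
    rw [this]
    simp
  have hlin : ∫ t in (0 : ℝ)..1, (a + t) = a + 1 / 2 := by
    rw [intervalIntegral.integral_add (by simp) (by simp)]
    simp
  have hint : IntervalIntegrable (fun t : ℝ => a + t) volume 0 1 :=
    (by fun_prop : Continuous fun t : ℝ => a + t).intervalIntegrable _ _
  have hsub := intervalIntegral.integral_sub hint (intervalIntegrable_floor_const_add a)
  simp only [Int.self_sub_floor] at hsub
  rw [hfr, hlin] at hsub
  linarith

theorem Int.floor_sub_floor_eq_zero_or_one {x y : ℝ} (h0 : 0 ≤ x - y) (h1 : x - y ≤ 1) :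
    ⌊x⌋ - ⌊y⌋ = 0 ∨ ⌊x⌋ - ⌊y⌋ = 1 := by
  have h2 : ⌊y⌋ ≤ ⌊x⌋ := Int.floor_mono (by linarith)
  have h3 : ⌊x⌋ ≤ ⌊y + 1⌋ := Int.floor_mono (by linarith)
  rw [Int.floor_add_one] at h3
  omega

theorem finite_setOf_isASM (n : ℕ) : {X | IsASM n X}.Finite := by
  have h : (Set.univ.pi fun _ : Fin n => Set.univ.pi fun _ : Fin n =>
      ({-1, 0, 1} : Set ℝ)).Finite :=
    Set.Finite.pi fun _ => Set.Finite.pi fun _ => Set.toFinite _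
  refine h.subset fun X hX => ?_
  simp only [Set.mem_pi, Set.mem_univ, forall_const, Set.mem_insert_iff, Set.mem_singleton_iff]
  exact hX.1

/-- Rounding the corner sums of a point of the polytope at a uniformly random threshold exhibits
the point as an average of left blocks of VSASMs. -/
theorem mem_convexHull_vsasm (k : ℕ) (hk : k ≤ 2 * k + 1) (y : ℕ → ℕ → ℝ)
    (hR : ∀ i < 2 * k + 1, ∀ b ≤ k,
      0 ≤ ∑ j ∈ Finset.range b, y i j ∧ ∑ j ∈ Finset.range b, y i j ≤ 1)
    (hC : ∀ a ≤ 2 * k + 1, ∀ j < k,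
      0 ≤ ∑ i ∈ Finset.range a, y i j ∧ ∑ i ∈ Finset.range a, y i j ≤ 1)
    (hS : ∀ i < 2 * k + 1, ∑ j ∈ Finset.range k, y i j = if i % 2 = 1 then 1 else 0)
    (hT : ∀ j < k, ∑ i ∈ Finset.range (2 * k + 1), y i j = 1) :
    (fun (i : Fin (2 * k + 1)) (j : Fin k) => y i j) ∈
      convexHull ℝ ((fun (X : Fin (2 * k + 1) → Fin (2 * k + 1) → ℝ) (i : Fin (2 * k + 1))
        (j : Fin k) => X i (Fin.castLE hk j)) ''
          {X | IsASM (2 * k + 1) X ∧ ∀ i j, X i j = X i j.rev}) := by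
  set S := ((fun (X : Fin (2 * k + 1) → Fin (2 * k + 1) → ℝ) (i : Fin (2 * k + 1))
        (j : Fin k) => X i (Fin.castLE hk j)) ''
          {X | IsASM (2 * k + 1) X ∧ ∀ i j, X i j = X i j.rev})
  have hfin : S.Finite := ((finite_setOf_isASM _).subset fun X hX => hX.1).image _
  set H : ℕ → ℕ → ℝ := fun a b => ∑ i ∈ Finset.range a, ∑ j ∈ Finset.range b, y i j with hH
  have hHrow : ∀ i b, H (i + 1) b - H i b = ∑ j ∈ Finset.range b, y i j := fun i b => by
    simp [hH, Finset.sum_range_succ]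
  have hHcol : ∀ a j, H a (j + 1) - H a j = ∑ i ∈ Finset.range a, y i j := fun a j => by
    simp [hH, Finset.sum_range_succ, Finset.sum_add_distrib]
  have hHmid : ∀ a ≤ 2 * k + 1, H a k = (a / 2 : ℕ) := by
    intro a
    induction a with
    | zero => simp [hH]
    | succ a ih =>
      intro ha
      have h1 := hHrow a k
      rw [hS a (by omega), ih (by omega)] at h1
      rw [sub_eq_iff_eq_add.1 h1]
      split_ifs with h
      · rw [show (a + 1) / 2 = 1 + a / 2 by omega]
        push_cast
        ring
      · rw [show (a + 1) / 2 = a / 2 by omega, zero_add]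
  have hHbot : ∀ b ≤ k, H (2 * k + 1) b = b := by
    intro b hb
    simp only [hH]
    rw [Finset.sum_comm, Finset.sum_congr rfl fun j hj =>
      hT j ((Finset.mem_range.1 hj).trans_le hb)]
    simp
  set G : ℝ → ℕ → ℕ → ℤ := fun t a b => ⌊H a b + t⌋ with hG
  set f : ℝ → Fin (2 * k + 1) → Fin k → ℝ := fun t i j =>
    ((G t (i + 1) (j + 1) - G t i (j + 1) - (G t (i + 1) j - G t i j) : ℤ) : ℝ) with hf
  have hfS : ∀ t ∈ Set.Ico (0 : ℝ) 1, f t ∈ S := by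
    intro t ht
    have ht0 : ⌊t⌋ = 0 := Int.floor_eq_zero_iff.2 ht
    obtain ⟨X, hX, hXf⟩ := exists_vsasm_of_cornerSum k hk (G t)
      (fun b _ => by simp [hG, hH, ht0]) (fun a _ => by simp [hG, hH, ht0])
      (fun a ha => by simp only [hG, hHmid a ha]; rw [Int.floor_natCast_add, ht0, add_zero])
      (fun b hb => by simp only [hG, hHbot b hb]; rw [Int.floor_natCast_add, ht0, add_zero])
      (fun i hi b hb => by
        have h := hR i hi b hb
        rw [← hHrow] at h
        exact Int.floor_sub_floor_eq_zero_or_one (by linarith) (by linarith))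
      (fun a ha j hj => by
        have h := hC a ha j hj
        rw [← hHcol] at h
        exact Int.floor_sub_floor_eq_zero_or_one (by linarith) (by linarith))
    exact ⟨X, hX, funext fun i => funext fun j => hXf i j⟩
  set μ : Measure ℝ := volume.restrict (Set.Ico 0 1) with hμ
  have : IsProbabilityMeasure μ := ⟨by simp [hμ]⟩
  have hGint : ∀ a b, Integrable (fun t => (G t a b : ℝ)) μ := fun a b =>
    (intervalIntegrable_iff_integrableOn_Ico_of_le zero_le_one).1
      (intervalIntegrable_floor_const_add (H a b))
  have hGval : ∀ a b, ∫ t, (G t a b : ℝ) ∂μ = H a b := fun a b => by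
    rw [← integral_floor_const_add (H a b), intervalIntegral.integral_of_le zero_le_one,
      ← integral_Ico_eq_integral_Ioc]
  have hDint : ∀ a b c d, Integrable (fun t => (G t a b : ℝ) - G t c d) μ := fun a b c d =>
    (hGint a b).sub (hGint c d)
  have hfint : ∀ i j, Integrable (fun t => f t i j) μ := fun i j => by
    simp only [hf, Int.cast_sub]
    exact (hDint _ _ _ _).sub (hDint _ _ _ _)
  have hfval : ∫ t, f t ∂μ = fun (i : Fin (2 * k + 1)) (j : Fin k) => y i j := by
    ext i j
    rw [eval_integral fun i => Integrable.of_eval (hfint i), eval_integral (hfint i)]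
    simp only [hf, Int.cast_sub]
    rw [integral_sub (hDint _ _ _ _) (hDint _ _ _ _), integral_sub (hGint _ _) (hGint _ _),
      integral_sub (hGint _ _) (hGint _ _)]
    simp only [hGval, hHrow, Finset.sum_range_succ]
    ring
  rw [← hfval]
  refine (convex_convexHull ℝ S).integral_mem (hfin.isClosed_convexHull ℝ) ?_
    (Integrable.of_eval fun i => Integrable.of_eval (hfint i))
  exact (ae_restrict_mem measurableSet_Ico).mono fun t ht => subset_convexHull ℝ S (hfS t ht)

/-- In a VSASM the middle column alternates, which determines the row sums of the left block. -/
theorem IsASM.sum_left_of_symm {k : ℕ} {x : ℕ → ℕ → ℝ}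
    (hX : IsASM (2 * k + 1) fun i j => x i j)
    (hsymm : ∀ i j : Fin (2 * k + 1), x i j = x i j.rev) (i : ℕ) (hi : i < 2 * k + 1) :
    ∑ j ∈ Finset.range k, x i j = if i % 2 = 1 then 1 else 0 := by
  obtain ⟨-, hrow, hcol, hrow1, -⟩ := hX
  have hmid : ∀ i < 2 * k + 1, 2 * ∑ j ∈ Finset.range k, x i j + x i k = 1 := by
    intro i hi
    rw [← Finset.sum_range_of_symm, ← Fin.sum_univ_eq_sum_range]
    · exact hrow1 ⟨i, hi⟩
    · intro m hm
      have := hsymm ⟨i, hi⟩ ⟨m, by omega⟩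
      simp only [Fin.val_rev] at this
      rw [this]
      congr 1
      omega
  have hleft : ∀ i < 2 * k + 1, ∑ j ∈ Finset.range k, x i j = 0 ∨
      ∑ j ∈ Finset.range k, x i j = 1 := by
    intro i hi
    rcases Nat.eq_zero_or_pos k with rfl | hk
    · simp
    · have := hrow ⟨i, hi⟩ ⟨k - 1, by omega⟩
      rw [Fin.sum_Iic_eq_sum_range (fun m => x i m)] at this
      simpa only [Nat.sub_add_cancel hk] using this
  have hpre : ∀ a ≤ 2 * k + 1, ∑ i ∈ Finset.range a, x i k = if a % 2 = 1 then 1 else 0 := by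
    intro a
    induction a with
    | zero => simp
    | succ a ih =>
      intro ha
      have h1 := hcol ⟨a, ha⟩ ⟨k, by omega⟩
      rw [Fin.sum_Iic_eq_sum_range (fun m => x m k)] at h1
      simp only at h1
      have h2 := ih (by omega)
      have h3 := hmid a ha
      rw [Finset.sum_range_succ, h2] at h1
      rw [Finset.sum_range_succ, h2]
      rcases Nat.mod_two_eq_zero_or_one a with h | h <;>
        simp only [Nat.succ_mod_two_eq_one_iff, h] at h1 ⊢ <;> norm_num at h1 ⊢ <;>
        rcases hleft a ha with h4 | h4 <;> rw [h4] at h3 <;> rcases h1 with h1 | h1 <;> linarith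
  have h1 := hpre i hi.le
  have h2 := hpre (i + 1) hi
  rw [Finset.sum_range_succ, h1] at h2
  have h3 := hmid i hi
  rcases Nat.mod_two_eq_zero_or_one i with h | h <;>
    simp only [Nat.succ_mod_two_eq_one_iff, h] at h2 ⊢ <;> norm_num at h2 ⊢ <;> linarith

theorem convex_vsasm_core (n k : ℕ) :
    Convex ℝ {Y : Fin n → Fin k → ℝ |
      (∀ i : Fin n, ∀ j : Fin k, (j : ℕ) + 1 < k →
        0 ≤ ∑ j' ∈ Finset.Iic j, Y i j' ∧ ∑ j' ∈ Finset.Iic j, Y i j' ≤ 1) ∧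
      (∀ i : Fin n, ∀ j : Fin k, (i : ℕ) + 1 < n →
        0 ≤ ∑ i' ∈ Finset.Iic i, Y i' j ∧ ∑ i' ∈ Finset.Iic i, Y i' j ≤ 1) ∧
      (∀ i : Fin n, (∑ j, Y i j) = if (i : ℕ) % 2 = 1 then 1 else 0) ∧
      (∀ j : Fin k, (∑ i, Y i j) = 1)} := by
  rintro Y ⟨h1, h2, h3, h4⟩ Z ⟨g1, g2, g3, g4⟩ a b ha hb hab
  have hmem : ∀ {u v : ℝ}, 0 ≤ u ∧ u ≤ 1 → 0 ≤ v ∧ v ≤ 1 →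
      0 ≤ a * u + b * v ∧ a * u + b * v ≤ 1 := fun hu hv =>
    (convex_Icc (0 : ℝ) 1) hu hv ha hb hab
  have heq : ∀ c : ℝ, a * c + b * c = c := fun c => by rw [← add_mul, hab, one_mul]
  simp only [Set.mem_ofPred_eq, Pi.add_apply, Pi.smul_apply, smul_eq_mul, Finset.sum_add_distrib,
    ← Finset.mul_sum]
  refine ⟨fun i j hj => hmem (h1 i j hj) (g1 i j hj), fun i j hi => hmem (h2 i j hi) (g2 i j hi),
    fun i => ?_, fun j => ?_⟩
  · rw [h3, g3, heq]
  · rw [h4, g4, heq]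

/-- Linear description of the core polytope of vertically symmetric ASMs:
the convex hull of the left `n × ⌊n/2⌋` blocks of VSASMs. -/
theorem VSASM_core_polytope (n : ℕ) (hn : 1 ≤ n) (hodd : Odd n) :
    convexHull ℝ
        ((fun (X : Fin n → Fin n → ℝ) (i : Fin n) (j : Fin (n / 2)) =>
            X i (Fin.castLE (Nat.div_le_self n 2) j)) ''
          {X | IsASM n X ∧ ∀ i j, X i j = X i j.rev})
      = {Y : Fin n → Fin (n / 2) → ℝ |
          (∀ i : Fin n, ∀ j : Fin (n / 2), (j : ℕ) + 1 < n / 2 →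
            0 ≤ ∑ j' ∈ Finset.Iic j, Y i j' ∧ ∑ j' ∈ Finset.Iic j, Y i j' ≤ 1) ∧
          (∀ i : Fin n, ∀ j : Fin (n / 2), (i : ℕ) + 1 < n →
            0 ≤ ∑ i' ∈ Finset.Iic i, Y i' j ∧ ∑ i' ∈ Finset.Iic i, Y i' j ≤ 1) ∧
          (∀ i : Fin n, (∑ j, Y i j) = if (i : ℕ) % 2 = 1 then 1 else 0) ∧
          (∀ j : Fin (n / 2), (∑ i, Y i j) = 1)} := by
  obtain ⟨k, rfl⟩ := hodd
  have hm : (2 * k + 1) / 2 = k := by omega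
  generalize_proofs hle
  generalize (2 * k + 1) / 2 = m at hm hle ⊢
  subst hm
  apply Set.Subset.antisymm
  · refine convexHull_min ?_ (convex_vsasm_core _ _)
    rintro _ ⟨X, ⟨hX, hsymm⟩, rfl⟩
    obtain ⟨x, rfl⟩ := exists_nat_extension X
    have hX' := hX
    obtain ⟨-, hrow, hcol, -, hcol1⟩ := hX
    have h01 : ∀ {u : ℝ}, u = 0 ∨ u = 1 → 0 ≤ u ∧ u ≤ 1 := by
      rintro u (rfl | rfl) <;> norm_num
    refine ⟨fun i j _ => ?_, fun i j _ => h01 (hcol i _), fun i => ?_, fun j => hcol1 _⟩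
    · have := hrow i (Fin.castLE hle j)
      rw [Fin.sum_Iic_eq_sum_range (fun m => x i m)] at this
      simp only [Fin.val_castLE] at this ⊢
      rw [Fin.sum_Iic_eq_sum_range (fun m => x i m)]
      exact h01 this
    · simp only [Fin.val_castLE]
      rw [Fin.sum_univ_eq_sum_range (fun m => x i m)]
      exact hX'.sum_left_of_symm hsymm i i.2
  · rintro Y ⟨h1, h2, h3, h4⟩
    obtain ⟨y, rfl⟩ := exists_nat_extension Y
    have hS : ∀ i < 2 * m + 1, ∑ j ∈ Finset.range m, y i j = if i % 2 = 1 then 1 else 0 := by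
      intro i hi
      rw [← Fin.sum_univ_eq_sum_range]
      exact h3 ⟨i, hi⟩
    have hT : ∀ j < m, ∑ i ∈ Finset.range (2 * m + 1), y i j = 1 := by
      intro j hj
      rw [← Fin.sum_univ_eq_sum_range (fun i => y i j)]
      exact h4 ⟨j, hj⟩
    refine mem_convexHull_vsasm m hle y ?_ ?_ hS hT
    · intro i hi b hb
      rcases hb.eq_or_lt with rfl | hb
      · rw [hS i hi]
        split_ifs <;> norm_num
      · cases b with
        | zero => simp
        | succ j =>
          have := h1 ⟨i, hi⟩ ⟨j, by omega⟩ hb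
          rwa [Fin.sum_Iic_eq_sum_range (fun m => y i m)] at this
    · intro a ha j hj
      rcases ha.eq_or_lt with rfl | ha
      · rw [hT j hj]
        norm_num
      · cases a with
        | zero => simp
        | succ i =>
          have := h2 ⟨i, by omega⟩ ⟨j, hj⟩ ha
          rwa [Fin.sum_Iic_eq_sum_range (fun m => y m j)] at this
end

section
/- For every n ≥ 1, the dimension of the convex hull of the n×n half-turn symmetric ASMs in ℝ^{n×n} equals ⌈(n−1)²/2⌉. -/
/-- The sum of the first `i` entries of a vector. -/
def prefixSum (n i : ℕ) : (Fin n → ℝ) →ₗ[ℝ] ℝ where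
  toFun f := ∑ x : Fin n, if (x : ℕ) < i then f x else 0
  map_add' f g := by
    rw [← Finset.sum_add_distrib]
    exact Finset.sum_congr rfl fun x _ => by split_ifs <;> simp
  map_smul' r f := by
    simp [Finset.mul_sum]

theorem prefixSum_apply (n i : ℕ) (f : Fin n → ℝ) :
    prefixSum n i f = ∑ x : Fin n, if (x : ℕ) < i then f x else 0 := rfl

theorem prefixSum_zero (n : ℕ) (f : Fin n → ℝ) : prefixSum n 0 f = 0 := by
  simp [prefixSum_apply]

theorem prefixSum_self (n : ℕ) (f : Fin n → ℝ) : prefixSum n n f = ∑ x, f x := by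
  simp [prefixSum_apply]

theorem prefixSum_succ {n : ℕ} (x : Fin n) (f : Fin n → ℝ) :
    prefixSum n (x + 1) f = prefixSum n x f + f x := by
  have h : f x = ∑ y, if y = x then f y else 0 := by simp
  rw [prefixSum_apply, prefixSum_apply, h, ← Finset.sum_add_distrib]
  refine Finset.sum_congr rfl fun y _ => ?_
  rcases lt_trichotomy y x with hyx | rfl | hyx
  · have : (y : ℕ) < x := hyx
    simp [hyx.ne, this, this.trans (Nat.lt_succ_self _)]
  · simp
  · have : (x : ℕ) < y := hyx
    simp [hyx.ne', not_lt.2 this.le, not_lt.2 (Nat.succ_le_of_lt this)]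

theorem sum_Iic_eq_prefixSum {n : ℕ} (x : Fin n) (f : Fin n → ℝ) :
    ∑ y ∈ Finset.Iic x, f y = prefixSum n (x + 1) f := by
  rw [prefixSum_apply, ← Finset.sum_filter]
  refine Finset.sum_congr (Finset.ext fun y => ?_) fun _ _ => rfl
  rw [Finset.mem_Iic, Finset.mem_filter, Nat.lt_succ_iff, Fin.le_def]
  simp

theorem prefixSum_sub {n : ℕ} (F : ℕ → ℝ) {i : ℕ} (hi : i ≤ n) :
    prefixSum n i (fun x => F (x + 1) - F x) = F i - F 0 := by
  induction i with
  | zero => simp [prefixSum_zero]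
  | succ i ih =>
    have h := prefixSum_succ (⟨i, hi⟩ : Fin n) (fun x => F (x + 1) - F x)
    simp only at h
    rw [h, ih (by omega)]
    ring

theorem prefixSum_rev {n i : ℕ} (hi : i ≤ n) (f : Fin n → ℝ) :
    prefixSum n (n - i) (fun x => f x.rev) = ∑ x, f x - prefixSum n i f := by
  rw [prefixSum_apply, prefixSum_apply, ← Finset.sum_sub_distrib,
    ← Equiv.sum_comp Fin.revPerm (fun x => f x - _)]
  refine Finset.sum_congr rfl fun x _ => ?_
  have h : (x : ℕ) < n - i ↔ ¬ (x.rev : ℕ) < i := by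
    rw [Fin.val_rev]; omega
  rw [Fin.revPerm_apply]
  by_cases h' : (x.rev : ℕ) < i
  · rw [if_neg (h.not.2 (not_not.2 h')), if_pos h', sub_self]
  · rw [if_pos (h.2 h'), if_neg h', sub_zero]

/-- The sum of the entries in the upper left `i × j` corner of a matrix. -/
def cornerSum (n i j : ℕ) : (Fin n → Fin n → ℝ) →ₗ[ℝ] ℝ :=
  prefixSum n i ∘ₗ LinearMap.pi fun x => prefixSum n j ∘ₗ LinearMap.proj x

theorem cornerSum_apply (n i j : ℕ) (X : Fin n → Fin n → ℝ) :
    cornerSum n i j X = prefixSum n i fun x => prefixSum n j (X x) := rfl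

theorem eq_zero_of_cornerSum_eq_zero {n : ℕ} {X : Fin n → Fin n → ℝ}
    (h : ∀ i j, i ≤ n → j ≤ n → cornerSum n i j X = 0) : X = 0 := by
  have hrow (x : Fin n) (j : ℕ) (hj : j ≤ n) : prefixSum n j (X x) = 0 := by
    have h₁ := h (x + 1) j x.isLt hj
    rw [cornerSum_apply, prefixSum_succ, ← cornerSum_apply, h x j x.isLt.le hj] at h₁
    simpa using h₁
  funext x y
  have h₁ := hrow x (y + 1) y.isLt
  rw [prefixSum_succ, hrow x y y.isLt.le] at h₁
  simpa using h₁

/-- The half-turn symmetric matrices with vanishing row and column sums. -/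
def halfTurnDirection (n : ℕ) : Submodule ℝ (Fin n → Fin n → ℝ) where
  carrier := {X | (∀ x, ∑ y, X x y = 0) ∧ (∀ y, ∑ x, X x y = 0) ∧
    ∀ x y, X x y = X x.rev y.rev}
  zero_mem' := by simp
  add_mem' := by
    rintro X Y ⟨hX₁, hX₂, hX₃⟩ ⟨hY₁, hY₂, hY₃⟩
    refine ⟨fun x => ?_, fun y => ?_, fun x y => ?_⟩
    · simp [Finset.sum_add_distrib, hX₁, hY₁]
    · simp [Finset.sum_add_distrib, hX₂, hY₂]
    · simp [← hX₃ x y, ← hY₃ x y]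
  smul_mem' := by
    rintro r X ⟨hX₁, hX₂, hX₃⟩
    refine ⟨fun x => ?_, fun y => ?_, fun x y => ?_⟩
    · simp [← Finset.mul_sum, hX₁]
    · simp [← Finset.mul_sum, hX₂]
    · simp [← hX₃ x y]

theorem cornerSum_rev {n : ℕ} {X : Fin n → Fin n → ℝ} (hX : X ∈ halfTurnDirection n)
    {i j : ℕ} (hi : i ≤ n) (hj : j ≤ n) :
    cornerSum n (n - i) (n - j) X = cornerSum n i j X := by
  obtain ⟨hrow, hcol, hsymm⟩ := hX
  have h (x : Fin n) : prefixSum n (n - j) (X x) = -prefixSum n j (X x.rev) := by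
    have h₁ := prefixSum_rev hj (X x.rev)
    rw [hrow, zero_sub] at h₁
    rw [← h₁]
    exact congrArg _ (funext fun y => hsymm x y)
  have hsum : ∑ x, prefixSum n j (X x) = 0 := by
    rw [← map_sum, ← map_zero (prefixSum n j)]
    refine congrArg _ (funext fun y => ?_)
    simp [hcol]
  rw [cornerSum_apply, cornerSum_apply]
  simp only [h]
  rw [prefixSum_rev hi fun x => -prefixSum n j (X x), Finset.sum_neg_distrib, hsum]
  have hneg := map_neg (prefixSum n i) fun x => prefixSum n j (X x)
  rw [show (fun x => -prefixSum n j (X x)) = -fun x => prefixSum n j (X x) from rfl, hneg]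
  simp

/-- The set of half-turn symmetric alternating sign matrices. -/
def HTSASM (n : ℕ) : Set (Fin n → Fin n → ℝ) :=
  {X | IsASM n X ∧ ∀ i j, X i j = X i.rev j.rev}

theorem vectorSpan_HTSASM_le (n : ℕ) : vectorSpan ℝ (HTSASM n) ≤ halfTurnDirection n := by
  refine Submodule.span_le.2 ?_
  rintro _ ⟨X, ⟨⟨-, -, -, hX₁, hX₂⟩, hX₃⟩, Y, ⟨⟨-, -, -, hY₁, hY₂⟩, hY₃⟩, rfl⟩
  refine ⟨fun x => ?_, fun y => ?_, fun x y => ?_⟩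
  · simp [hX₁, hY₁]
  · simp [hX₂, hY₂]
  · simp [← hX₃ x y, ← hY₃ x y]

/-- The corner sum matrices of half-turn symmetric alternating sign matrices. -/
structure IsCornerSum (n : ℕ) (c : ℕ → ℕ → ℤ) : Prop where
  left : ∀ i ≤ n, c i 0 = 0
  top : ∀ j ≤ n, c 0 j = 0
  right : ∀ i ≤ n, c i n = i
  bottom : ∀ j ≤ n, c n j = j
  step_row : ∀ i j, i < n → j ≤ n → c (i + 1) j = c i j ∨ c (i + 1) j = c i j + 1
  step_col : ∀ i j, i ≤ n → j < n → c i (j + 1) = c i j ∨ c i (j + 1) = c i j + 1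
  symm : ∀ i j, i ≤ n → j ≤ n → c (n - i) (n - j) = n - i - j + c i j

/-- The matrix of mixed differences of a function on the grid. -/
def mixedDiff (n : ℕ) (c : ℕ → ℕ → ℤ) (x y : Fin n) : ℝ :=
  ((c (x + 1) (y + 1) : ℝ) - c x (y + 1)) - (c (x + 1) y - c x y)

theorem prefixSum_mixedDiff_row {n : ℕ} {c : ℕ → ℕ → ℤ} (hc : IsCornerSum n c)
    (x : Fin n) {j : ℕ} (hj : j ≤ n) :
    prefixSum n j (mixedDiff n c x) = (c (x + 1) j : ℝ) - c x j := by
  have h := prefixSum_sub (fun j => (c (x + 1) j : ℝ) - c x j) hj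
  simp only [hc.left _ x.isLt.le, hc.left _ (Nat.succ_le_of_lt x.isLt)] at h
  rw [Int.cast_zero, sub_zero, sub_zero] at h
  exact h

theorem prefixSum_mixedDiff_col {n : ℕ} {c : ℕ → ℕ → ℤ} (hc : IsCornerSum n c)
    (y : Fin n) {i : ℕ} (hi : i ≤ n) :
    prefixSum n i (fun x => mixedDiff n c x y) = (c i (y + 1) : ℝ) - c i y := by
  have h := prefixSum_sub (fun i => (c i (y + 1) : ℝ) - c i y) hi
  simp only [hc.top _ y.isLt.le, hc.top _ (Nat.succ_le_of_lt y.isLt)] at h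
  rw [Int.cast_zero, sub_zero, sub_zero] at h
  rw [← h]
  refine congrArg _ (funext fun x => ?_)
  simp only [mixedDiff]
  ring

theorem cornerSum_mixedDiff {n : ℕ} {c : ℕ → ℕ → ℤ} (hc : IsCornerSum n c)
    {i j : ℕ} (hi : i ≤ n) (hj : j ≤ n) : cornerSum n i j (mixedDiff n c) = c i j := by
  rw [cornerSum_apply]
  simp only [prefixSum_mixedDiff_row hc _ hj]
  rw [prefixSum_sub (fun i => (c i j : ℝ)) hi, hc.top j hj]
  simp

theorem mixedDiff_mem_HTSASM {n : ℕ} {c : ℕ → ℕ → ℤ} (hc : IsCornerSum n c) :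
    mixedDiff n c ∈ HTSASM n := by
  have hrow (x : Fin n) (j : ℕ) (hj : j ≤ n) :
      (c (x + 1) j : ℝ) - c x j = 0 ∨ (c (x + 1) j : ℝ) - c x j = 1 := by
    rcases hc.step_row x j x.isLt hj with h | h <;> simp [h]
  have hcol (y : Fin n) (i : ℕ) (hi : i ≤ n) :
      (c i (y + 1) : ℝ) - c i y = 0 ∨ (c i (y + 1) : ℝ) - c i y = 1 := by
    rcases hc.step_col i y hi y.isLt with h | h <;> simp [h]
  refine ⟨⟨fun x y => ?_, fun x y => ?_, fun x y => ?_, fun x => ?_, fun y => ?_⟩, fun x y => ?_⟩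
  · unfold mixedDiff
    rcases hrow x (y + 1) y.isLt with h₁ | h₁ <;> rcases hrow x y y.isLt.le with h₂ | h₂ <;>
      simp [h₁, h₂]
  · rw [sum_Iic_eq_prefixSum, prefixSum_mixedDiff_row hc x y.isLt]
    exact hrow x (y + 1) y.isLt
  · rw [sum_Iic_eq_prefixSum x fun x => mixedDiff n c x y, prefixSum_mixedDiff_col hc y x.isLt]
    exact hcol y (x + 1) x.isLt
  · rw [← prefixSum_self, prefixSum_mixedDiff_row hc x le_rfl, hc.right _ x.isLt,
      hc.right _ x.isLt.le]
    simp
  · rw [← prefixSum_self n fun x => mixedDiff n c x y, prefixSum_mixedDiff_col hc y le_rfl,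
      hc.bottom _ y.isLt, hc.bottom _ y.isLt.le]
    simp
  · have hx := x.isLt
    have hy := y.isLt
    have h₁ := hc.symm (x + 1) (y + 1) hx hy
    have h₂ := hc.symm x (y + 1) hx.le hy
    have h₃ := hc.symm (x + 1) y hx hy.le
    have h₄ := hc.symm x y hx.le hy.le
    have ex : n - (x : ℕ) = n - (x + 1) + 1 := by omega
    have ey : n - (y : ℕ) = n - (y + 1) + 1 := by omega
    rw [ex] at h₂ h₄
    rw [ey] at h₃ h₄
    simp only [mixedDiff, Fin.val_rev, h₁, h₂, h₃, h₄]
    push_cast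
    ring

/-- The entrywise clamp, between the least and the greatest corner sum matrix, of the function
`⌊(i + j - a) / 2⌋`. -/
def clampedCorner (n : ℕ) (a : ℤ) (i j : ℕ) : ℤ :=
  max (max 0 ((i : ℤ) + j - n)) (min (min i j) (((i : ℤ) + j - a) / 2))

theorem isCornerSum_clampedCorner (n : ℕ) (a : ℤ) : IsCornerSum n (clampedCorner n a) := by
  constructor <;> intros <;> unfold clampedCorner
  · omega
  · omega
  · omega
  · omega
  · omega
  · omega
  · omega

/-- The function `c`, increased by one at `(i₀, j₀)` and its half-turn image. -/
def raise (n i₀ j₀ : ℕ) (c : ℕ → ℕ → ℤ) (i j : ℕ) : ℤ :=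
  c i j + if (i = i₀ ∧ j = j₀) ∨ (i + i₀ = n ∧ j + j₀ = n) then 1 else 0

theorem isCornerSum_raise {n i₀ j₀ : ℕ} {c : ℕ → ℕ → ℤ} (hc : IsCornerSum n c)
    (hi₀ : 0 < i₀) (hi₀n : i₀ < n) (hj₀ : 0 < j₀) (hj₀n : j₀ < n)
    (h : ∀ i j, (i = i₀ ∧ j = j₀) ∨ (i + i₀ = n ∧ j + j₀ = n) →
      c (i + 1) j = c i j + 1 ∧ c (i - 1) j = c i j ∧
      c i (j + 1) = c i j + 1 ∧ c i (j - 1) = c i j) :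
    IsCornerSum n (raise n i₀ j₀ c) := by
  constructor <;> intro i <;> unfold raise
  · intro hi
    rw [hc.left i hi, if_neg (by omega), add_zero]
  · intro hj
    rw [hc.top i hj, if_neg (by omega), add_zero]
  · intro hi
    rw [hc.right i hi, if_neg (by omega), add_zero]
  · intro hj
    rw [hc.bottom i hj, if_neg (by omega), add_zero]
  · intro j hi hj
    have h₁ := hc.step_row i j hi hj
    split_ifs with h₂ h₃ h₃
    · omega
    · have h₄ := (h _ _ h₂).2.1
      rw [Nat.add_sub_cancel] at h₄
      simp [h₄]
    · simp [(h _ _ h₃).1]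
    · simpa using h₁
  · intro j hi hj
    have h₁ := hc.step_col i j hi hj
    split_ifs with h₂ h₃ h₃
    · omega
    · have h₄ := (h _ _ h₂).2.2.2
      rw [Nat.add_sub_cancel] at h₄
      simp [h₄]
    · simp [(h _ _ h₃).2.2.1]
    · simpa using h₁
  · intro j hi hj
    rw [hc.symm i j hi hj, add_assoc]
    have hiff : (n - i = i₀ ∧ n - j = j₀ ∨ n - i + i₀ = n ∧ n - j + j₀ = n) ↔
        (i = i₀ ∧ j = j₀ ∨ i + i₀ = n ∧ j + j₀ = n) := by omega
    simp only [hiff]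

theorem isCornerSum_raise_clampedCorner {n i₀ j₀ : ℕ} (hi₀ : 0 < i₀) (hi₀n : i₀ < n)
    (hj₀ : 0 < j₀) (hj₀n : j₀ < n) :
    IsCornerSum n (raise n i₀ j₀ (clampedCorner n (|(i₀ : ℤ) - j₀| + 1))) := by
  refine isCornerSum_raise (isCornerSum_clampedCorner n _) hi₀ hi₀n hj₀ hj₀n fun i j hij => ?_
  have hi : 0 < i ∧ i < n := by omega
  have hj : 0 < j ∧ j < n := by omega
  have habs : |(i₀ : ℤ) - j₀| = |(i : ℤ) - j| := by
    rcases hij with ⟨rfl, rfl⟩ | ⟨hi, hj⟩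
    · rfl
    · rw [abs_sub_comm]
      congr 1
      omega
  rw [habs]
  clear hij habs hi₀ hi₀n hj₀ hj₀n
  unfold clampedCorner
  rcases abs_cases ((i : ℤ) - j) with ⟨h, h'⟩ | ⟨h, h'⟩ <;> rw [h] <;> clear h <;>
    refine ⟨?_, ?_, ?_, ?_⟩ <;> omega

/-- The corner sums at the first half, in lexicographic order, of the interior grid points. -/
def halfCornerSums (m : ℕ) :
    (Fin (m + 1) → Fin (m + 1) → ℝ) →ₗ[ℝ] (Fin ((m ^ 2 + 1) / 2) → ℝ) :=
  LinearMap.pi fun k => cornerSum (m + 1) (k / m + 1) (k % m + 1)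

theorem halfCornerSums_apply (m : ℕ) (X : Fin (m + 1) → Fin (m + 1) → ℝ)
    (k : Fin ((m ^ 2 + 1) / 2)) :
    halfCornerSums m X k = cornerSum (m + 1) (k / m + 1) (k % m + 1) X := rfl

theorem eq_zero_of_halfCornerSums_eq_zero {m : ℕ} {X : Fin (m + 1) → Fin (m + 1) → ℝ}
    (hX : X ∈ halfTurnDirection (m + 1)) (h : halfCornerSums m X = 0) : X = 0 := by
  have hlow (p q : ℕ) (hq : q < m) (hpq : p * m + q < (m ^ 2 + 1) / 2) :
      cornerSum (m + 1) (p + 1) (q + 1) X = 0 := by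
    have h₁ := congrFun h ⟨p * m + q, hpq⟩
    rw [halfCornerSums_apply, Pi.zero_apply] at h₁
    have hm : 0 < m := by omega
    have hdiv : (p * m + q) / m = p := by
      rw [mul_comm, Nat.mul_add_div hm, Nat.div_eq_of_lt hq, add_zero]
    have hmod : (p * m + q) % m = q := by
      rw [mul_comm, Nat.mul_add_mod, Nat.mod_eq_of_lt hq]
    simpa only [hdiv, hmod] using h₁
  have hint (p q : ℕ) (hp : p < m) (hq : q < m) :
      cornerSum (m + 1) (p + 1) (q + 1) X = 0 := by
    by_cases hpq : p * m + q < (m ^ 2 + 1) / 2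
    · exact hlow p q hq hpq
    · have hsum : (m - 1 - p) * m + (m - 1 - q) + (p * m + q) + 1 = m ^ 2 := by
        obtain ⟨a, rfl⟩ : ∃ a, m = p + 1 + a := ⟨m - (p + 1), by omega⟩
        obtain ⟨b, hb⟩ : ∃ b, p + 1 + a = q + 1 + b := ⟨p + 1 + a - (q + 1), by omega⟩
        have h₁ : p + 1 + a - 1 - p = a := by omega
        have h₂ : p + 1 + a - 1 - q = b := by omega
        rw [h₁, h₂]
        linear_combination -hb
      have h₁ := hlow (m - 1 - p) (m - 1 - q) (by omega) (by omega)
      rw [← cornerSum_rev hX (by omega) (by omega)] at h₁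
      rwa [show m + 1 - (m - 1 - p + 1) = p + 1 by omega,
        show m + 1 - (m - 1 - q + 1) = q + 1 by omega] at h₁
  have hleft (i : ℕ) : cornerSum (m + 1) i 0 X = 0 := by
    simp [cornerSum_apply, prefixSum_apply]
  have htop (j : ℕ) : cornerSum (m + 1) 0 j X = 0 := prefixSum_zero _ _
  refine eq_zero_of_cornerSum_eq_zero fun i j hi hj => ?_
  rcases i with _ | p
  · exact htop j
  rcases j with _ | q
  · exact hleft (p + 1)
  by_cases hp : p = m
  · rw [← cornerSum_rev hX hi hj, hp, Nat.sub_self]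
    exact htop _
  by_cases hq : q = m
  · rw [← cornerSum_rev hX hi hj, hq, Nat.sub_self]
    exact hleft _
  exact hint p q (by omega) (by omega)

theorem exists_halfCornerSums_eq_single {m : ℕ} (k : Fin ((m ^ 2 + 1) / 2)) :
    ∃ X ∈ vectorSpan ℝ (HTSASM (m + 1)), halfCornerSums m X = Pi.single k 1 := by
  have hm : 0 < m := by
    rcases Nat.eq_zero_or_pos m with rfl | hm
    · exact absurd k.isLt (by simp)
    · exact hm
  have hlt (l : Fin ((m ^ 2 + 1) / 2)) : (l : ℕ) / m < m := by
    have := l.isLt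
    rw [Nat.div_lt_iff_lt_mul hm, ← sq]
    have : 0 < m ^ 2 := by positivity
    omega
  have hlt' (l : Fin ((m ^ 2 + 1) / 2)) : (l : ℕ) % m < m := Nat.mod_lt _ hm
  have hk := hlt k
  have hk' := hlt' k
  have hf := isCornerSum_clampedCorner (m + 1) (|((k / m + 1 : ℕ) : ℤ) - (k % m + 1 : ℕ)| + 1)
  have hr := isCornerSum_raise_clampedCorner (Nat.succ_pos _) (Nat.succ_lt_succ hk)
    (Nat.succ_pos _) (Nat.succ_lt_succ hk')
  refine ⟨_, vsub_mem_vectorSpan ℝ (mixedDiff_mem_HTSASM hr) (mixedDiff_mem_HTSASM hf), ?_⟩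
  funext l
  have hl := hlt l
  have hl' := hlt' l
  rw [vsub_eq_sub, halfCornerSums_apply, map_sub, cornerSum_mixedDiff hr (by omega) (by omega),
    cornerSum_mixedDiff hf (by omega) (by omega), raise, Int.cast_add, add_sub_cancel_left,
    Pi.single_apply]
  have hdl := Nat.div_add_mod (l : ℕ) m
  have hdk := Nat.div_add_mod (k : ℕ) m
  by_cases hlk : l = k
  · simp [hlk]
  rw [if_neg hlk, if_neg, Int.cast_zero]
  rintro (⟨h₁, h₂⟩ | ⟨h₁, h₂⟩) <;> refine hlk (Fin.ext ?_)
  · rw [← hdl, ← hdk, Nat.succ_injective h₁, Nat.succ_injective h₂]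
  · have hsum : (l : ℕ) + k + 1 = m ^ 2 := by
      have h₃ : (l : ℕ) / m + k / m + 1 = m := by omega
      have h₄ : (l : ℕ) % m + k % m + 1 = m := by omega
      linear_combination m * h₃ + h₄ - hdl - hdk
    have := l.isLt
    have := k.isLt
    omega

theorem finrank_vectorSpan_HTSASM (m : ℕ) :
    Module.finrank ℝ (vectorSpan ℝ (HTSASM (m + 1))) = (m ^ 2 + 1) / 2 := by
  let L := (halfCornerSums m).domRestrict (vectorSpan ℝ (HTSASM (m + 1)))
  have hinj : Function.Injective L := by
    rw [injective_iff_map_eq_zero]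
    intro X hX
    exact Subtype.ext (eq_zero_of_halfCornerSums_eq_zero (vectorSpan_HTSASM_le _ X.2) hX)
  have hsurj : Function.Surjective L := by
    choose v hv hLv using exists_halfCornerSums_eq_single (m := m)
    intro g
    refine ⟨∑ k, g k • ⟨v k, hv k⟩, ?_⟩
    rw [map_sum]
    simp only [map_smul]
    have h (k : Fin ((m ^ 2 + 1) / 2)) : L ⟨v k, hv k⟩ = Pi.single k 1 := hLv k
    funext l
    simp [h, Pi.single_apply]
  rw [(LinearEquiv.ofBijective L ⟨hinj, hsurj⟩).finrank_eq, Module.finrank_fin_fun]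

/-- The dimension of the polytope of `n × n` half-turn symmetric ASMs is
`⌈(n-1)²/2⌉ = ((n-1)² + 1)/2`. -/
theorem HTSASM_polytope_dim (n : ℕ) (hn : 1 ≤ n) :
    Module.finrank ℝ
        ↥(vectorSpan ℝ
          (convexHull ℝ
            {X : Fin n → Fin n → ℝ | IsASM n X ∧ ∀ i j, X i j = X i.rev j.rev}))
      = ((n - 1) ^ 2 + 1) / 2 := by
  obtain ⟨m, rfl⟩ : ∃ m, n = m + 1 := ⟨n - 1, by omega⟩
  rw [← direction_affineSpan, affineSpan_convexHull, direction_affineSpan]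
  exact finrank_vectorSpan_HTSASM m
end
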